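/- Let k ≥ 2. The number of critical configurations of the dollar game on the complete graph K_k with a fixed bank vertex b, where configurations are identified with their tuples of values at the k−1 non-bank vertices (each value in {0,…,k−2}), equals k^{k−2}. -/

import Mathlib

open Finset

/-- Firing the vertex `u` on the complete graph `K_k` with vertex set
`{0, …, k-1}`: `u` loses `k-1` dollars and every other vertex gains one. -/
def fireK (k u : ℕ) (d : ℕ → ℤ) : ℕ → ℤ := fun v =>
  if v = u then d u - ((k : ℤ) - 1)
  else if v ≤ k - 1 then d v + 1
  else d v

/-- A configuration on `K_k` (vertices `{0,…,k-1}`, bank vertex `0`) is stable: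
every non-bank vertex has value in `{0, …, k-2}`. -/
def StableK (k : ℕ) (d : ℕ → ℤ) : Prop :=
  ∀ v, 1 ≤ v → v ≤ k - 1 → 0 ≤ d v ∧ d v ≤ (k : ℤ) - 2

/-- A stable configuration `d` on the complete graph `K_k` (vertices
`{0,…,k-1}`, bank vertex `0`) is critical: there is a nonempty `0`-legal firing
sequence starting and ending at `d` (non-bank vertices are fired only when
their value is `≥ k-1`; the bank is fired only at a stable configuration). -/
def CriticalK (k : ℕ) (d : ℕ → ℤ) : Prop :=
  StableK k d ∧
  ∃ (N : ℕ) (cs : ℕ → ℕ → ℤ) (vs : ℕ → ℕ),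
    1 ≤ N ∧ cs 0 = d ∧ cs N = d ∧
    (∀ j < N, vs j ≤ k - 1) ∧
    (∀ j < N, cs (j + 1) = fireK k (vs j) (cs j)) ∧
    (∀ j < N, vs j ≠ 0 → (k : ℤ) - 1 ≤ cs j (vs j)) ∧
    (∀ j < N, vs j = 0 → StableK k (cs j))

/-- The configuration on `K_k` determined by a tuple of values (in `{0,…,k-2}`)
at the `k-1` non-bank vertices `1, …, k-1`; the bank vertex gets the value `0`
(criticality does not depend on the bank's value). -/
def tupleConfK (k : ℕ) (g : Fin (k - 1) → Fin (k - 1)) : ℕ → ℤ :=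
  fun v => if h : 1 ≤ v ∧ v ≤ k - 1 then ((g ⟨v - 1, by omega⟩).val : ℤ) else 0

/-! ### Firing sequences -/

/-- After `m` firings a vertex has gained `m` dollars and lost `k` for each of its own firings. -/
theorem fireK_sequence_apply {k m : ℕ} {cs : ℕ → ℕ → ℤ} {vs : ℕ → ℕ}
    (hstep : ∀ j < m, cs (j + 1) = fireK k (vs j) (cs j)) {v : ℕ} (hv : v ≤ k - 1) :
    cs m v = cs 0 v + m - k * #{i ∈ range m | vs i = v} := by
  induction m with
  | zero => simp
  | succ m ih =>
    have hih := ih fun j hj => hstep j (by omega)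
    rw [hstep m (by omega), fireK, range_add_one, filter_insert]
    by_cases h : vs m = v
    · subst h
      rw [if_pos rfl, if_pos rfl, card_insert_of_notMem (by simp), hih]
      push_cast
      ring
    · rw [if_neg (Ne.symm h), if_pos hv, if_neg h, hih]
      push_cast
      ring

/-- Along a legal firing sequence the non-bank values stay nonnegative. -/
theorem nonneg_of_legal {k N : ℕ} {cs : ℕ → ℕ → ℤ} {vs : ℕ → ℕ}
    (hstable : StableK k (cs 0))
    (hstep : ∀ j < N, cs (j + 1) = fireK k (vs j) (cs j))
    (hlegal : ∀ j < N, vs j ≠ 0 → (k : ℤ) - 1 ≤ cs j (vs j))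
    {v : ℕ} (hv1 : 1 ≤ v) (hvk : v ≤ k - 1) {j : ℕ} (hj : j ≤ N) : 0 ≤ cs j v := by
  induction j with
  | zero => exact (hstable v hv1 hvk).1
  | succ j ih =>
    have hih := ih (by omega)
    rw [hstep j hj, fireK]
    by_cases h : v = vs j
    · have := hlegal j hj (by omega)
      rw [if_pos h]
      omega
    · rw [if_neg h, if_pos hvk]
      omega

/-- Every nonempty set `A` of non-bank vertices of a critical configuration contains a vertex
with at least `#A - 1` dollars. -/
theorem CriticalK.exists_card_le {k : ℕ} {d : ℕ → ℤ} (hd : CriticalK k d)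
    {A : Finset ℕ} (hA : ∀ v ∈ A, 1 ≤ v ∧ v ≤ k - 1) (hne : A.Nonempty) :
    ∃ v ∈ A, (#A : ℤ) ≤ d v + 1 := by
  obtain ⟨hstable, N, cs, vs, hN, h0, hend, -, hstep, hlegal, -⟩ := hd
  have hlast : ∀ v ∈ A, ∃ t < N, vs t = v ∧ ∀ j < N, vs j = v → j ≤ t := by
    intro v hv
    have hcount := fireK_sequence_apply hstep (hA v hv).2
    rw [h0, hend] at hcount
    have hfired : ({i ∈ range N | vs i = v} : Finset ℕ).Nonempty := by
      rw [nonempty_iff_ne_empty]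
      intro hempty
      rw [hempty, card_empty] at hcount
      push_cast at hcount
      omega
    obtain ⟨t, ht, hmax⟩ := exists_max_image _ id hfired
    simp only [mem_filter, mem_range, id] at ht hmax
    exact ⟨t, ht.1, ht.2, fun j hj hjv => hmax j ⟨hj, hjv⟩⟩
  choose! t htN htv htmax using hlast
  obtain ⟨v, hv, hmin⟩ := exists_min_image A t hne
  refine ⟨v, hv, ?_⟩
  have hcard : #(A.erase v) ≤ #(Ioo (t v) N) := by
    apply card_le_card_of_injOn t
    · intro u hu
      rw [mem_coe, mem_erase] at hu
      rw [mem_coe, mem_Ioo]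
      refine ⟨lt_of_le_of_ne (hmin u hu.2) fun h => hu.1 ?_, htN u hu.2⟩
      rw [← htv u hu.2, ← h, htv v hv]
    · intro u hu w hw h
      rw [mem_coe, mem_erase] at hu hw
      rw [← htv u hu.2, h, htv w hw.2]
  rw [card_erase_of_mem hv, Nat.card_Ioo] at hcard
  have htvN := htN v hv
  have htail := fireK_sequence_apply (m := N - (t v + 1))
    (cs := fun j => cs (t v + 1 + j)) (vs := fun j => vs (t v + 1 + j))
    (fun j hj => hstep (t v + 1 + j) (by omega)) (hA v hv).2
  have hquiet : ({i ∈ range (N - (t v + 1)) | vs (t v + 1 + i) = v} : Finset ℕ) = ∅ := by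
    rw [filter_eq_empty_iff]
    intro i hi h
    rw [mem_range] at hi
    have := htmax v hv (t v + 1 + i) (by omega) h
    omega
  have hnonneg := nonneg_of_legal (h0 ▸ hstable) hstep hlegal (hA v hv).1 (hA v hv).2
    (j := t v + 1) htvN
  simp only [hquiet, card_empty, Nat.add_zero, Nat.add_sub_cancel' (show t v + 1 ≤ N from htvN),
    hend] at htail
  push_cast [Nat.cast_sub (show t v + 1 ≤ N from htvN)] at htail
  omega

/-! ### Criticality as a parking condition -/

theorem tupleConfK_succ {n : ℕ} (g : Fin n → Fin n) (i : Fin n) :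
    tupleConfK (n + 1) g (i + 1) = (g i : ℤ) := by
  have hi := i.isLt
  rw [tupleConfK, dif_pos (by omega)]
  rfl

theorem stableK_tupleConfK {n : ℕ} (g : Fin n → Fin n) :
    StableK (n + 1) (tupleConfK (n + 1) g) := by
  intro v hv1 hvn
  obtain ⟨i, rfl⟩ : ∃ i : Fin n, v = i + 1 := ⟨⟨v - 1, by omega⟩, by simp; omega⟩
  rw [tupleConfK_succ]
  have := (g i).isLt
  push_cast
  omega

theorem CriticalK.card_filter_lt_le {n : ℕ} {g : Fin n → Fin n}
    (hg : CriticalK (n + 1) (tupleConfK (n + 1) g)) (m : ℕ) : #{i | (g i : ℕ) < m} ≤ m := by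
  by_contra! hm
  have hinj : Function.Injective fun i : Fin n => (i : ℕ) + 1 := fun i j h => by
    simpa [Fin.ext_iff] using h
  obtain ⟨v, hv, hle⟩ := hg.exists_card_le
    (A := ({i | (g i : ℕ) < m} : Finset (Fin n)).image fun i : Fin n => (i : ℕ) + 1)
    (by
      intro v hv
      obtain ⟨i, -, rfl⟩ := mem_image.1 hv
      have := i.isLt
      omega)
    ((card_pos.1 (by omega)).image _)
  obtain ⟨i, hi, rfl⟩ := mem_image.1 hv
  rw [card_image_of_injective _ hinj, tupleConfK_succ] at hle
  have := (mem_filter.1 hi).2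
  omega

theorem exists_perm_le_add {n : ℕ} {g : Fin n → Fin n}
    (hg : ∀ m, #{i | (g i : ℕ) < m} ≤ m) :
    ∃ σ : Equiv.Perm (Fin n), ∀ i : Fin n, n ≤ g (σ i) + (i + 1) := by
  refine ⟨Fin.revPerm.trans (Tuple.sort g), fun i => ?_⟩
  by_contra! hlt
  have hmono := Tuple.monotone_sort g
  have hi := i.isLt
  have hsub : (Iic i.rev).image (Tuple.sort g) ⊆
      ({j | (g j : ℕ) < n - (i + 1)} : Finset (Fin n)) := by
    intro j hj
    obtain ⟨l, hl, rfl⟩ := mem_image.1 hj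
    have h1 : (g (Tuple.sort g l) : ℕ) ≤ g (Tuple.sort g i.rev) := hmono (mem_Iic.1 hl)
    have h2 : (g (Tuple.sort g i.rev) : ℕ) + (i + 1) < n := hlt
    rw [mem_filter]
    exact ⟨mem_univ _, by omega⟩
  have hcard := (card_le_card hsub).trans (hg _)
  rw [card_image_of_injective _ (Tuple.sort g).injective, Fin.card_Iic, Fin.val_rev] at hcard
  omega

theorem criticalK_of_card_filter_lt_le {n : ℕ} {g : Fin n → Fin n}
    (hg : ∀ m, #{i | (g i : ℕ) < m} ≤ m) : CriticalK (n + 1) (tupleConfK (n + 1) g) := by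
  obtain ⟨σ, hσ⟩ := exists_perm_le_add hg
  set d := tupleConfK (n + 1) g
  let vs : ℕ → ℕ := fun j => if h : 1 ≤ j ∧ j ≤ n then σ ⟨j - 1, by omega⟩ + 1 else 0
  obtain ⟨cs, hcs_zero, hstep⟩ : ∃ cs : ℕ → ℕ → ℤ,
      cs 0 = d ∧ ∀ j, cs (j + 1) = fireK (n + 1) (vs j) (cs j) :=
    ⟨fun j => Nat.rec d (fun i c => fireK (n + 1) (vs i) c) j, rfl, fun _ => rfl⟩
  have hvs_succ : ∀ i : Fin n, vs (i + 1) = σ i + 1 := fun i => by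
    have := i.isLt
    simp only [vs]
    rw [dif_pos (by omega)]
    rfl
  have hvs_zero : vs 0 = 0 := rfl
  have hcases : ∀ j < n + 1, j = 0 ∨ ∃ i : Fin n, j = i + 1 := fun j hj => by
    rcases j with _ | j
    · exact Or.inl rfl
    · exact Or.inr ⟨⟨j, by omega⟩, rfl⟩
  have hcs : ∀ m, ∀ v ≤ n, cs m v = d v + m - (n + 1 : ℕ) * #{i ∈ range m | vs i = v} :=
    fun m v hv => hcs_zero ▸ fireK_sequence_apply (fun j _ => hstep j) hv
  have hvs_le : ∀ j < n + 1, vs j ≤ n := by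
    intro j hj
    obtain rfl | ⟨i, rfl⟩ := hcases j hj
    · omega
    · have := (σ i).isLt
      rw [hvs_succ]
      omega
  have hvs_inj : ∀ i < n + 1, ∀ j < n + 1, vs i = vs j → i = j := by
    intro i hi j hj h
    obtain rfl | ⟨i, rfl⟩ := hcases i hi <;> obtain rfl | ⟨j, rfl⟩ := hcases j hj
    · rfl
    · rw [hvs_succ, hvs_zero] at h
      omega
    · rw [hvs_succ, hvs_zero] at h
      omega
    · rw [hvs_succ, hvs_succ, Nat.add_right_cancel_iff, ← Fin.ext_iff] at h
      rw [σ.injective h]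
  have hvs_surj : ∀ v ≤ n, ∃ j < n + 1, vs j = v := by
    intro v hv
    obtain rfl | ⟨i, rfl⟩ := hcases v (by omega)
    · exact ⟨0, by omega, rfl⟩
    · refine ⟨σ.symm i + 1, by omega, ?_⟩
      rw [hvs_succ, σ.apply_symm_apply]
  refine ⟨stableK_tupleConfK g, n + 1, cs, vs, by omega, hcs_zero, ?_, hvs_le, fun j _ => hstep j,
    ?_, ?_⟩
  · ext v
    by_cases hv : v ≤ n
    · rw [hcs _ v hv]
      obtain ⟨j, hj, hjv⟩ := hvs_surj v hv
      have hone : ({i ∈ range (n + 1) | vs i = v} : Finset ℕ) = {j} := by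
        ext i
        rw [mem_filter, mem_range, mem_singleton]
        refine ⟨fun h => hvs_inj i h.1 j hj (h.2.trans hjv.symm), ?_⟩
        rintro rfl
        exact ⟨hj, hjv⟩
      rw [hone, card_singleton]
      push_cast
      ring
    · have hconst : ∀ j ≤ n + 1, cs j v = d v := by
        intro j hj
        induction j with
        | zero => rw [hcs_zero]
        | succ j ih =>
          have := hvs_le j (by omega)
          rw [hstep, fireK, if_neg (by omega), if_neg (by omega), ih (by omega)]
      exact hconst _ le_rfl
  · intro j hj hne
    obtain rfl | ⟨i, rfl⟩ := hcases j hj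
    · exact absurd hvs_zero hne
    rw [hcs _ _ (hvs_le _ hj)]
    have hnone : ({l ∈ range ((i : ℕ) + 1) | vs l = vs (i + 1)} : Finset ℕ) = ∅ := by
      rw [filter_eq_empty_iff]
      intro l hl h
      rw [mem_range] at hl
      have := hvs_inj l (by omega) _ hj h
      omega
    have hσi := hσ i
    have hval : d (vs (i + 1)) = (g (σ i) : ℤ) := by
      rw [hvs_succ]
      exact tupleConfK_succ g (σ i)
    rw [hnone, card_empty, hval]
    push_cast
    omega
  · intro j hj hzero
    obtain rfl | ⟨i, rfl⟩ := hcases j hj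
    · rw [hcs_zero]
      exact stableK_tupleConfK g
    · rw [hvs_succ] at hzero
      omega

theorem criticalK_tupleConfK_iff {n : ℕ} (g : Fin n → Fin n) :
    CriticalK (n + 1) (tupleConfK (n + 1) g) ↔ ∀ m, #{i | (g i : ℕ) < m} ≤ m :=
  ⟨fun h => h.card_filter_lt_le, criticalK_of_card_filter_lt_le⟩

/-! ### Counting parking functions -/

/-- Cycle lemma: a sequence that drops by one over each period `p` has exactly one starting point
in a period from which it does not go below its starting value before the period is over. -/
theorem existsUnique_start_of_drop {p : ℕ} (hp : 0 < p) {S : ℕ → ℤ}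
    (hS : ∀ t, S (t + p) = S t - 1) :
    ∃! s, s < p ∧ ∀ j < p, S s ≤ S (s + j) := by
  have hex : ∃ s, s < p ∧ ∀ t < p, S s ≤ S t := by
    obtain ⟨s, hs, hmin⟩ := exists_min_image (range p) S ⟨0, mem_range.2 hp⟩
    exact ⟨s, mem_range.1 hs, fun t ht => hmin t (mem_range.2 ht)⟩
  classical
  obtain ⟨hs, hmin⟩ := Nat.find_spec hex
  have hfirst := fun t => Nat.find_min (m := t) hex
  generalize Nat.find hex = s at hs hmin hfirst
  have hmain : ∀ j < p, S s ≤ S (s + j) := by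
    intro j hj
    by_cases h : s + j < p
    · exact hmin _ h
    have hdrop := hS (s + j - p)
    rw [Nat.sub_add_cancel (by omega)] at hdrop
    have hnot := hfirst (s + j - p) (by omega)
    push Not at hnot
    obtain ⟨u, hu, hlt⟩ := hnot (by omega)
    have := hmin u hu
    omega
  have hle : ∀ a b, a < p → b < p → (∀ j < p, S a ≤ S (a + j)) →
      (∀ j < p, S b ≤ S (b + j)) → b ≤ a := by
    intro a b ha hb hSa hSb
    by_contra! hlt
    have h1 := hSa (b - a) (by omega)
    have h2 := hSb (a + p - b) (by omega)
    rw [Nat.add_sub_cancel' hlt.le] at h1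
    rw [Nat.add_sub_cancel' (by omega), hS] at h2
    omega
  exact ⟨s, ⟨hs, hmain⟩, fun a ha =>
    le_antisymm (hle s a hs ha.1 hmain ha.2) (hle a s ha.1 hs ha.2 hmain)⟩

/-- Parking functions of length `n`, with values taken in `ZMod (n + 1)`. -/
def IsParking {n : ℕ} (F : Fin n → ZMod (n + 1)) : Prop :=
  ∀ j ≤ n, j ≤ #{v | (F v).val < j}

theorem card_filter_val_sub_lt {n : ℕ} (F : Fin n → ZMod (n + 1)) (s : ZMod (n + 1)) {j : ℕ}
    (hj : j ≤ n + 1) :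
    #{v | (F v - s).val < j} = ∑ i ∈ range j, #{v | F v = s + (i : ZMod (n + 1))} := by
  rw [card_eq_sum_card_fiberwise (f := fun v => (F v - s).val) (t := range j)
    (fun v hv => by simpa using hv)]
  refine sum_congr rfl fun i hi => ?_
  rw [mem_range] at hi
  rw [filter_filter]
  congr 1
  refine filter_congr fun v _ => ⟨?_, fun h => ?_⟩
  · rintro ⟨-, rfl⟩
    rw [ZMod.natCast_zmod_val, add_sub_cancel]
  · rw [h, add_sub_cancel_left, ZMod.val_natCast_of_lt (by omega)]
    exact ⟨hi, rfl⟩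

theorem existsUnique_isParking_sub {n : ℕ} (F : Fin n → ZMod (n + 1)) :
    ∃! s : ZMod (n + 1), IsParking fun v => F v - s := by
  let S : ℕ → ℤ := fun t => ∑ i ∈ range t, ((#{v | F v = (i : ZMod (n + 1))} : ℤ) - 1)
  have hadd : ∀ t j, j ≤ n + 1 →
      S (t + j) = S t + #{v | (F v - (t : ZMod (n + 1))).val < j} - j := by
    intro t j hj
    rw [card_filter_val_sub_lt F _ hj]
    simp only [S, sum_range_add, Nat.cast_add, sum_sub_distrib, sum_const, card_range, nsmul_eq_mul,
      Nat.cast_sum]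
    ring
  have hdrop : ∀ t, S (t + (n + 1)) = S t - 1 := by
    intro t
    rw [hadd t _ le_rfl, filter_true_of_mem fun v _ => ZMod.val_lt _, card_univ, Fintype.card_fin]
    push_cast
    ring
  have hiff : ∀ t : ℕ, (IsParking fun v => F v - (t : ZMod (n + 1))) ↔
      ∀ j < n + 1, S t ≤ S (t + j) := by
    intro t
    refine forall_congr' fun j => ?_
    rw [Nat.lt_succ_iff]
    refine forall_congr' fun hj => ?_
    rw [hadd t j (by omega)]
    dsimp only
    omega
  obtain ⟨s, ⟨hs, hsS⟩, huniq⟩ := existsUnique_start_of_drop n.succ_pos hdrop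
  refine ⟨s, (hiff s).2 hsS, fun a ha => ?_⟩
  rw [← ZMod.natCast_zmod_val a] at ha ⊢
  rw [huniq a.val ⟨ZMod.val_lt a, (hiff _).1 ha⟩]

theorem card_isParking_mul (n : ℕ) :
    Nat.card {F : Fin n → ZMod (n + 1) // IsParking F} * (n + 1) = (n + 1) ^ n := by
  have hbij : Function.Bijective
      fun x : {F : Fin n → ZMod (n + 1) // IsParking F} × ZMod (n + 1) =>
        fun v => x.1.1 v + x.2 := by
    constructor
    · rintro ⟨⟨F, hF⟩, s⟩ ⟨⟨G, hG⟩, t⟩ h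
      have heq : ∀ v, F v + s = G v + t := fun v => congrFun h v
      obtain rfl : s = t := (existsUnique_isParking_sub fun v => F v + s).unique
        (by simpa using hF) (by simpa [heq] using hG)
      obtain rfl : F = G := funext fun v => add_right_cancel (heq v)
      rfl
    · intro F
      obtain ⟨s, hs, -⟩ := existsUnique_isParking_sub F
      exact ⟨(⟨_, hs⟩, s), funext fun v => sub_add_cancel _ _⟩
  have hcard := Nat.card_eq_of_bijective _ hbij
  rwa [Nat.card_prod, Nat.card_fun, Nat.card_zmod, Nat.card_eq_fintype_card (α := Fin n),
    Fintype.card_fin] at hcard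

/-- The complement `n - 1 - g` of a tuple `g`, with values in `ZMod (n + 1)`. -/
def complTuple {n : ℕ} (g : Fin n → Fin n) : Fin n → ZMod (n + 1) :=
  fun v => ((g v).rev : ℕ)

theorem val_complTuple {n : ℕ} (g : Fin n → Fin n) (v : Fin n) :
    (complTuple g v).val = (g v).rev :=
  ZMod.val_natCast_of_lt (by omega)

theorem isParking_complTuple_iff {n : ℕ} (g : Fin n → Fin n) :
    IsParking (complTuple g) ↔ ∀ m, #{i | (g i : ℕ) < m} ≤ m := by
  have hcompl : ∀ j ≤ n, #{v | (complTuple g v).val < j} + #{v | (g v : ℕ) < n - j} = n := by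
    intro j hj
    have hfilter : ({v | (complTuple g v).val < j} : Finset (Fin n)) =
        ({v | ¬ (g v : ℕ) < n - j} : Finset (Fin n)) := by
      refine filter_congr fun v _ => ?_
      have := (g v).isLt
      rw [val_complTuple, Fin.val_rev]
      omega
    rw [hfilter, add_comm, card_filter_add_card_filter_not, card_univ, Fintype.card_fin]
  constructor
  · intro h m
    by_cases hm : m ≤ n
    · have h1 := h (n - m) (by omega)
      have h2 := hcompl (n - m) (by omega)
      rw [Nat.sub_sub_self hm] at h2
      omega
    · have := card_le_univ ({i | (g i : ℕ) < m} : Finset (Fin n))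
      rw [Fintype.card_fin] at this
      omega
  · intro h j hj
    have h1 := h (n - j)
    have h2 := hcompl j hj
    omega

theorem IsParking.val_lt {n : ℕ} {F : Fin n → ZMod (n + 1)} (hF : IsParking F) (v : Fin n) :
    (F v).val < n := by
  have huniv : ({v | (F v).val < n} : Finset (Fin n)) = univ := by
    rw [← card_eq_iff_eq_univ, Fintype.card_fin]
    refine le_antisymm ?_ (hF n le_rfl)
    simpa using card_le_univ ({v | (F v).val < n} : Finset (Fin n))
  have hv := mem_univ v
  rw [← huniv] at hv
  exact (mem_filter.1 hv).2

theorem card_criticalK_eq_card_isParking (n : ℕ) :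
    Nat.card {g : Fin n → Fin n // CriticalK (n + 1) (tupleConfK (n + 1) g)} =
      Nat.card {F : Fin n → ZMod (n + 1) // IsParking F} := by
  refine Nat.card_eq_of_bijective (fun g => ⟨complTuple g.1,
    (isParking_complTuple_iff g.1).2 ((criticalK_tupleConfK_iff g.1).1 g.2)⟩) ⟨?_, ?_⟩
  · rintro ⟨g, hg⟩ ⟨g₂, hg₂⟩ h
    have heq : complTuple g = complTuple g₂ := congrArg Subtype.val h
    refine Subtype.ext (funext fun v => Fin.rev_injective (Fin.ext ?_))
    change ((g v).rev : ℕ) = (g₂ v).rev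
    rw [← val_complTuple, ← val_complTuple, heq]
  · rintro ⟨F, hF⟩
    have hcompl : complTuple (fun v => (⟨(F v).val, hF.val_lt v⟩ : Fin n).rev) = F := by
      funext v
      rw [complTuple, Fin.rev_rev, ZMod.natCast_zmod_val]
    exact ⟨⟨_, (criticalK_tupleConfK_iff _).2 ((isParking_complTuple_iff _).1 (hcompl.symm ▸ hF))⟩,
      Subtype.ext hcompl⟩

/-- For `k ≥ 2`, the number of critical configurations of the dollar game on
the complete graph `K_k` with a fixed bank vertex, identified with their tuples
of values at the `k-1` non-bank vertices, equals `k^{k-2}`. -/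
theorem card_critical_complete (k : ℕ) (hk : 2 ≤ k) :
    Nat.card {g : Fin (k - 1) → Fin (k - 1) // CriticalK k (tupleConfK k g)} =
      k ^ (k - 2) := by
  obtain ⟨n, rfl⟩ := Nat.exists_eq_add_of_le' hk
  refine (card_criticalK_eq_card_isParking (n + 1)).trans ?_
  have hmul := card_isParking_mul (n + 1)
  rw [pow_succ] at hmul
  exact Nat.eq_of_mul_eq_mul_right (by omega) hmul
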